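/- Let Z be a set of six points in the complex projective plane ℙ² such that no three of the points are collinear and Z is not contained in a conic. Let I be the radical homogeneous ideal of Z. Then α̂(I) = 12/5. -/

import Mathlib

open scoped LinearAlgebra.Projectivization

/-- A polynomial `F` vanishes to order at least `m` at the (affine representative) point
`v`: all iterated partial derivatives of order `≤ m - 1` (i.e. of order `< m`) vanish at `v`. -/
def VanishesToOrder (m : ℕ) (F : MvPolynomial (Fin 3) ℂ) (v : Fin 3 → ℂ) : Prop :=
  ∀ k : ℕ, k < m → ∀ d : Fin k → Fin 3,
    MvPolynomial.eval v ((List.ofFn d).foldl (fun p i => MvPolynomial.pderiv i p) F) = 0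

/-- The `m`-th symbolic power of the (radical) ideal of a set `Z` of points of `ℙ²`:
all polynomials vanishing to order at least `m` at every point of `Z`. -/
def symbolicPower (Z : Set (ℙ ℂ (Fin 3 → ℂ))) (m : ℕ) : Set (MvPolynomial (Fin 3) ℂ) :=
  {F | ∀ P ∈ Z, ∀ (v : Fin 3 → ℂ) (hv : v ≠ 0),
    Projectivization.mk ℂ v hv = P → VanishesToOrder m F v}

/-- The initial degree `α` of a set of polynomials: the least `t` such that the set contains
a nonzero homogeneous polynomial of degree `t`. -/
noncomputable def initialDegree (S : Set (MvPolynomial (Fin 3) ℂ)) : ℕ :=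
  sInf {t | ∃ F ∈ S, F ≠ 0 ∧ F.IsHomogeneous t}

/-- The Waldschmidt constant `α̂(I) = inf_{m ≥ 1} α(I^(m))/m` of the radical ideal of `Z`. -/
noncomputable def waldschmidt (Z : Set (ℙ ℂ (Fin 3 → ℂ))) : ℝ :=
  ⨅ m : ℕ+, (initialDegree (symbolicPower Z (m : ℕ)) : ℝ) / ((m : ℕ) : ℝ)

/-- A (homogeneous equation of a) line in `ℙ²`: a nonzero homogeneous polynomial of degree 1. -/
def IsLine (L : MvPolynomial (Fin 3) ℂ) : Prop := L ≠ 0 ∧ L.IsHomogeneous 1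

/-- The point `x ∈ ℙ²` lies on the line (or curve) with equation `L`. -/
def MemLine (L : MvPolynomial (Fin 3) ℂ) (x : ℙ ℂ (Fin 3 → ℂ)) : Prop :=
  ∀ (v : Fin 3 → ℂ) (hv : v ≠ 0), Projectivization.mk ℂ v hv = x → MvPolynomial.eval v L = 0

/-- Three points of `ℙ²` are collinear if some line contains all of them. -/
def Collin (x y z : ℙ ℂ (Fin 3 → ℂ)) : Prop :=
  ∃ M, IsLine M ∧ MemLine M x ∧ MemLine M y ∧ MemLine M z

/-- `Z` is contained in a conic: the zero set of a nonzero homogeneous polynomial of degree 2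
(possibly degenerate). -/
def ContainedInConic (Z : Set (ℙ ℂ (Fin 3 → ℂ))) : Prop :=
  ∃ F : MvPolynomial (Fin 3) ℂ, F ≠ 0 ∧ F.IsHomogeneous 2 ∧ ∀ x ∈ Z, MemLine F x

section PointIdeal

open MvPolynomial

/-- The maximal ideal of polynomials vanishing at the affine point `v`. -/
noncomputable def pointIdeal (v : Fin 3 → ℂ) : Ideal (MvPolynomial (Fin 3) ℂ) :=
  RingHom.ker (eval v)

lemma mem_pointIdeal {v : Fin 3 → ℂ} {F : MvPolynomial (Fin 3) ℂ} :
    F ∈ pointIdeal v ↔ eval v F = 0 := RingHom.mem_ker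

/-- A ring homomorphism sending an ideal into another one does so for their powers. -/
lemma map_mem_pow_of_forall_mem {R S : Type*} [CommRing R] [CommRing S] (f : R →+* S)
    {I : Ideal R} {J : Ideal S} (h : ∀ x ∈ I, f x ∈ J) {n : ℕ} {x : R} (hx : x ∈ I ^ n) :
    f x ∈ J ^ n := by
  have hle : I.map f ≤ J := Ideal.map_le_iff_le_comap.2 h
  have := Ideal.mem_map_of_mem f hx
  rw [Ideal.map_pow] at this
  exact Ideal.pow_right_mono hle n this

/-- The translation `F(X) ↦ F(X + v)`. -/
noncomputable def translateHom (v : Fin 3 → ℂ) :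
    MvPolynomial (Fin 3) ℂ →ₐ[ℂ] MvPolynomial (Fin 3) ℂ :=
  aeval fun i => X i + C (v i)

lemma eval_translateHom (v w : Fin 3 → ℂ) (F : MvPolynomial (Fin 3) ℂ) :
    eval w (translateHom v F) = eval (w + v) F := by
  induction F using MvPolynomial.induction_on with
  | C a => simp [translateHom]
  | add p q hp hq => simp [hp, hq]
  | mul_X p i hp => simp [hp]; simp [translateHom]

lemma translateHom_neg_translateHom (v : Fin 3 → ℂ) (F : MvPolynomial (Fin 3) ℂ) :
    translateHom (-v) (translateHom v F) = F :=
  MvPolynomial.funext fun w => by simp [eval_translateHom]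

lemma pderiv_translateHom (v : Fin 3 → ℂ) (i : Fin 3) (F : MvPolynomial (Fin 3) ℂ) :
    pderiv i (translateHom v F) = translateHom v (pderiv i F) := by
  induction F using MvPolynomial.induction_on with
  | C a => simp [translateHom]
  | add p q hp hq => simp [hp, hq]
  | mul_X p j hp =>
    have hX : pderiv i (translateHom v (X j)) = translateHom v (pderiv i (X j)) := by
      by_cases h : j = i
      · subst h; simp [translateHom]
      · simp [translateHom, pderiv_X_of_ne h]
    simp only [map_mul, Derivation.leibniz, smul_eq_mul, map_add, hp, hX]

lemma mem_idealOfVars_iff {F : MvPolynomial (Fin 3) ℂ} :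
    F ∈ idealOfVars (Fin 3) ℂ ↔ eval 0 F = 0 := by
  have h := mem_pow_idealOfVars_iff' 1 F
  rw [pow_one] at h
  rw [h]
  constructor
  · intro h
    simpa [constantCoeff_eq] using h 0 (by simp)
  · intro h d hd
    have : d = 0 := by
      rw [← Finsupp.degree_eq_zero_iff]; omega
    subst this
    simpa [constantCoeff_eq] using h

lemma mem_pointIdeal_pow_iff {v : Fin 3 → ℂ} {m : ℕ} {F : MvPolynomial (Fin 3) ℂ} :
    F ∈ pointIdeal v ^ m ↔ translateHom v F ∈ idealOfVars (Fin 3) ℂ ^ m := by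
  constructor
  · refine map_mem_pow_of_forall_mem (translateHom v).toRingHom fun x hx => ?_
    rw [mem_idealOfVars_iff]
    change eval 0 (translateHom v x) = 0
    rwa [eval_translateHom, zero_add, ← mem_pointIdeal]
  · intro h
    rw [← translateHom_neg_translateHom v F]
    refine map_mem_pow_of_forall_mem (translateHom (-v)).toRingHom (fun x hx => ?_) h
    rw [mem_idealOfVars_iff] at hx
    simpa [eval_translateHom, mem_pointIdeal] using hx

lemma mem_idealOfVars_pow_succ_iff {m : ℕ} {F : MvPolynomial (Fin 3) ℂ} :
    F ∈ idealOfVars (Fin 3) ℂ ^ (m + 1) ↔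
      eval 0 F = 0 ∧ ∀ i, pderiv i F ∈ idealOfVars (Fin 3) ℂ ^ m := by
  simp only [mem_pow_idealOfVars_iff']
  constructor
  · intro h
    refine ⟨by simpa [constantCoeff_eq] using h 0 (by simp), fun i d hd => ?_⟩
    rw [coeff_pderiv, h _ (by simpa using hd)]
    simp
  · rintro ⟨h0, h⟩ d hd
    by_cases hz : d = 0
    · subst hz; simpa [constantCoeff_eq] using h0
    · obtain ⟨i, hi⟩ := Finsupp.ne_iff.1 hz
      obtain ⟨e, rfl⟩ : ∃ e, d = e + Finsupp.single i 1 :=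
        ⟨d - Finsupp.single i 1, (tsub_add_cancel_of_le (by
          simpa [Nat.one_le_iff_ne_zero] using hi)).symm⟩
      have := h i e (by simpa using hd)
      rw [coeff_pderiv] at this
      rcases mul_eq_zero.1 this with h | h
      · exact h
      · exact absurd h (Nat.cast_add_one_ne_zero _)

lemma vanishesToOrder_succ_iff {m : ℕ} {F : MvPolynomial (Fin 3) ℂ} {v : Fin 3 → ℂ} :
    VanishesToOrder (m + 1) F v ↔ eval v F = 0 ∧ ∀ i, VanishesToOrder m (pderiv i F) v := by
  constructor
  · intro h
    refine ⟨by simpa using h 0 (by omega) Fin.elim0, fun i k hk d => ?_⟩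
    simpa [List.ofFn_succ] using h (k + 1) (by omega) (Fin.cons i d)
  · rintro ⟨h0, h⟩ k hk d
    cases k with
    | zero => simpa using h0
    | succ k => simpa [List.ofFn_succ] using h (d 0) k (by omega) (fun j => d j.succ)

lemma vanishesToOrder_iff {m : ℕ} {F : MvPolynomial (Fin 3) ℂ} {v : Fin 3 → ℂ} :
    VanishesToOrder m F v ↔ F ∈ pointIdeal v ^ m := by
  rw [mem_pointIdeal_pow_iff]
  induction m generalizing F with
  | zero => simp [VanishesToOrder]
  | succ m ih =>
    rw [vanishesToOrder_succ_iff, mem_idealOfVars_pow_succ_iff, eval_translateHom]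
    simp [ih, pderiv_translateHom]

lemma mem_pow_idealOfVars_iff_le_order {m : ℕ} {F : MvPolynomial (Fin 3) ℂ} :
    F ∈ idealOfVars (Fin 3) ℂ ^ m ↔ (m : ℕ∞) ≤ (F : MvPowerSeries (Fin 3) ℂ).order := by
  rw [mem_pow_idealOfVars_iff']
  constructor
  · intro h
    exact MvPowerSeries.nat_le_order fun d hd => by simpa using h d hd
  · intro h d hd
    rw [← coeff_coe]
    exact MvPowerSeries.coeff_of_lt_order (lt_of_lt_of_le (by exact_mod_cast hd) h)

/-- Dividing by a polynomial of order at most `k` at `v` lowers the order at `v` by at most `k`. -/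
lemma mem_pointIdeal_pow_of_mul_mem {v : Fin 3 → ℂ} {k m : ℕ} {Q H : MvPolynomial (Fin 3) ℂ}
    (hQ : Q ∉ pointIdeal v ^ (k + 1)) (h : Q * H ∈ pointIdeal v ^ m) :
    H ∈ pointIdeal v ^ (m - k) := by
  rw [mem_pointIdeal_pow_iff, mem_pow_idealOfVars_iff_le_order] at *
  rw [map_mul, coe_mul, MvPowerSeries.order_mul] at h
  generalize MvPowerSeries.order (translateHom v Q : MvPowerSeries (Fin 3) ℂ) = a at *
  generalize MvPowerSeries.order (translateHom v H : MvPowerSeries (Fin 3) ℂ) = b at *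
  have ha : a ≤ k := by
    rw [not_le] at hQ
    push_cast at hQ
    exact Order.le_of_lt_add_one hQ
  rw [ENat.natCast_sub, tsub_le_iff_left]
  exact h.trans (by gcongr)

end PointIdeal

section StandardConic

open MvPolynomial

lemma MvPolynomial.IsHomogeneous.add_eq_of_mem_support {t : ℕ} {G : MvPolynomial (Fin 3) ℂ}
    (hG : G.IsHomogeneous t) {d : Fin 3 →₀ ℕ} (hd : d ∈ G.support) : d 0 + d 1 + d 2 = t := by
  have h : Finsupp.weight (fun _ => 1) d = t := hG (mem_support_iff.1 hd)
  rw [← h, ← Finsupp.degree_eq_weight_one, Finsupp.degree_eq_sum, Fin.sum_univ_three]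

lemma MvPolynomial.IsHomogeneous.aeval_mul {S : Type*} [CommRing S] [Algebra ℂ S] {t : ℕ}
    {G : MvPolynomial (Fin 3) ℂ} (hG : G.IsHomogeneous t) (a : S) (f : Fin 3 → S) :
    MvPolynomial.aeval (fun i => a * f i) G = a ^ t * MvPolynomial.aeval f G := by
  conv_lhs => rw [G.as_sum]
  conv_rhs => rw [G.as_sum]
  rw [map_sum, map_sum, Finset.mul_sum]
  refine Finset.sum_congr rfl fun d hd => ?_
  rw [aeval_monomial, aeval_monomial, Finsupp.prod_fintype _ _ (by simp),
    Finsupp.prod_fintype _ _ (by simp), Fin.prod_univ_three, Fin.prod_univ_three,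
    ← hG.add_eq_of_mem_support hd]
  ring

/-- The equation `y² - xz` of the standard conic. -/
noncomputable def stdConic : MvPolynomial (Fin 3) ℂ := X 1 ^ 2 - X 0 * X 2

/-- The parametrization `s ↦ (1, s, s²)` of the standard conic. -/
noncomputable def stdCurve : Fin 3 → Polynomial ℂ := ![1, Polynomial.X, Polynomial.X ^ 2]

/-- The point `(1, s, s²)` of the standard conic. -/
def stdPoint (s : ℂ) : Fin 3 → ℂ := ![1, s, s ^ 2]

lemma isHomogeneous_stdConic : stdConic.IsHomogeneous 2 :=
  ((isHomogeneous_X ℂ (1 : Fin 3)).pow 2).sub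
    ((isHomogeneous_X ℂ (0 : Fin 3)).mul (isHomogeneous_X ℂ (2 : Fin 3)))

lemma stdConic_ne_zero : stdConic ≠ 0 := by
  intro h
  have := congrArg (eval ![0, 1, 0]) h
  simp [stdConic] at this

lemma stdConic_mem_pointIdeal (c s : ℂ) : stdConic ∈ pointIdeal (c • stdPoint s) := by
  rw [mem_pointIdeal]
  simp [stdConic, stdPoint]
  ring

lemma stdConic_notMem_pointIdeal_sq {c : ℂ} (hc : c ≠ 0) (s : ℂ) :
    stdConic ∉ pointIdeal (c • stdPoint s) ^ 2 := by
  rw [← vanishesToOrder_iff]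
  intro h
  have h1 := h 1 (by norm_num) ![2]
  simp [stdConic, stdPoint, pderiv_X, hc] at h1

/-- Modulo `y² - xz`, a monomial of degree `t` depends only on its value along the curve
`(1, s, s²)`. -/
lemma mk_monomial_stdConic (a b c : ℕ) :
    Ideal.Quotient.mk (Ideal.span {stdConic}) (X 0 ^ a * X 1 ^ b * X 2 ^ c) =
      Ideal.Quotient.mk (Ideal.span {stdConic})
        (if b + 2 * c ≤ a + b + c then
          X 0 ^ (a + b + c - (b + 2 * c)) * X 1 ^ (b + 2 * c)
        else X 1 ^ (2 * (a + b + c) - (b + 2 * c)) * X 2 ^ (b + 2 * c - (a + b + c))) := by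
  have key : Ideal.Quotient.mk (Ideal.span {stdConic}) (X 0 * X 2) =
      Ideal.Quotient.mk (Ideal.span {stdConic}) (X 1 ^ 2) := by
    rw [eq_comm, Ideal.Quotient.eq]
    exact Ideal.mem_span_singleton_self _
  split_ifs with h
  · obtain ⟨e, rfl⟩ : ∃ e, a = e + c := ⟨a - c, by omega⟩
    have h1 : (X 0 ^ (e + c) * X 1 ^ b * X 2 ^ c : MvPolynomial (Fin 3) ℂ) =
      X 0 ^ e * X 1 ^ b * (X 0 * X 2) ^ c := by ring
    rw [h1, map_mul, map_pow _ (X 0 * X 2), key, ← map_pow, ← map_mul]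
    congr 1
    rw [show e + c + b + c - (b + 2 * c) = e by omega]
    ring
  · obtain ⟨e, rfl⟩ : ∃ e, c = e + a := ⟨c - a, by omega⟩
    have h1 : (X 0 ^ a * X 1 ^ b * X 2 ^ (e + a) : MvPolynomial (Fin 3) ℂ) =
      X 1 ^ b * X 2 ^ e * (X 0 * X 2) ^ a := by ring
    rw [h1, map_mul, map_pow _ (X 0 * X 2), key, ← map_pow, ← map_mul]
    congr 1
    rw [show b + 2 * (e + a) - (a + b + (e + a)) = e by omega,
      show 2 * (a + b + (e + a)) - (b + 2 * (e + a)) = b + 2 * a by omega]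
    ring

/-- A homogeneous polynomial vanishing along the standard conic is divisible by its equation. -/
lemma stdConic_dvd_of_aeval_stdCurve_eq_zero {t : ℕ} {G : MvPolynomial (Fin 3) ℂ}
    (hG : G.IsHomogeneous t) (h : aeval stdCurve G = 0) : stdConic ∣ G := by
  let N : ℕ → MvPolynomial (Fin 3) ℂ ⧸ Ideal.span {stdConic} := fun k =>
    Ideal.Quotient.mk (Ideal.span {stdConic})
      (if k ≤ t then X 0 ^ (t - k) * X 1 ^ k else X 1 ^ (2 * t - k) * X 2 ^ (k - t))
  let ψ : Polynomial ℂ →ₗ[ℂ] MvPolynomial (Fin 3) ℂ ⧸ Ideal.span {stdConic} :=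
    (Polynomial.basisMonomials ℂ).constr ℂ N
  have hψ : ∀ (k : ℕ) (r : ℂ), ψ (Polynomial.C r * Polynomial.X ^ k) = r • N k := by
    intro k r
    have h1 : Polynomial.C r * Polynomial.X ^ k =
        r • (Polynomial.basisMonomials ℂ k) := by
      simp [Polynomial.C_mul_X_pow_eq_monomial, Polynomial.smul_monomial]
    rw [h1, map_smul, Module.Basis.constr_basis]
  have hmk : ψ (aeval stdCurve G) = Ideal.Quotient.mk (Ideal.span {stdConic}) G := by
    conv_rhs => rw [G.as_sum]
    conv_lhs => rw [G.as_sum]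
    rw [map_sum, map_sum, map_sum]
    refine Finset.sum_congr rfl fun d hd => ?_
    have hdeg := hG.add_eq_of_mem_support hd
    have hmon : monomial d (coeff d G) =
        C (coeff d G) * (X 0 ^ d 0 * X 1 ^ d 1 * X 2 ^ d 2) := by
      rw [monomial_eq, Finsupp.prod_fintype _ _ (by simp), Fin.prod_univ_three]
    have hcurve : aeval stdCurve (monomial d (coeff d G)) =
        Polynomial.C (coeff d G) * Polynomial.X ^ (d 1 + 2 * d 2) := by
      rw [hmon]
      simp [stdCurve, pow_add, pow_mul]
    rw [hcurve, hψ, hmon, ← smul_eq_C_mul]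
    have := mk_monomial_stdConic (d 0) (d 1) (d 2)
    rw [hdeg] at this
    change _ = Ideal.Quotient.mkₐ ℂ _ _
    rw [map_smul]
    exact congrArg _ this.symm
  rw [h, map_zero, eq_comm, Ideal.Quotient.eq_zero_iff_mem, Ideal.mem_span_singleton] at hmk
  exact hmk

lemma X_sub_C_pow_dvd_aeval_stdCurve {t m : ℕ} {G : MvPolynomial (Fin 3) ℂ}
    (hG : G.IsHomogeneous t) {c s : ℂ} (hc : c ≠ 0) (h : G ∈ pointIdeal (c • stdPoint s) ^ m) :
    (Polynomial.X - Polynomial.C s) ^ m ∣ aeval stdCurve G := by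
  have h1 := map_mem_pow_of_forall_mem
    (aeval (fun i => Polynomial.C c * stdCurve i) :
      MvPolynomial (Fin 3) ℂ →ₐ[ℂ] Polynomial ℂ).toRingHom
    (J := Ideal.span {Polynomial.X - Polynomial.C s}) (fun x hx => by
      rw [mem_pointIdeal] at hx
      rw [Ideal.mem_span_singleton, Polynomial.dvd_iff_isRoot, Polynomial.IsRoot.def, ← hx,
        ← Polynomial.coe_evalRingHom]
      change ((Polynomial.aeval s).comp (aeval (fun i => Polynomial.C c * stdCurve i))) x =
        aeval (c • stdPoint s) x
      congr 1
      ext i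
      fin_cases i <;> simp [stdCurve, stdPoint]) h
  rw [Ideal.span_singleton_pow, Ideal.mem_span_singleton] at h1
  change _ ∣ aeval (fun i => Polynomial.C c * stdCurve i) G at h1
  rw [hG.aeval_mul, ← map_pow] at h1
  exact (IsUnit.dvd_mul_left (Polynomial.isUnit_C.2 (pow_ne_zero t hc).isUnit)).1 h1

/-- Bézout's theorem for the standard conic: a form with too much vanishing along the conic is
divisible by its equation. -/
lemma stdConic_dvd_of_lt_sum {n t : ℕ} {G : MvPolynomial (Fin 3) ℂ} (hG : G.IsHomogeneous t)
    {c s : Fin n → ℂ} (hc : ∀ j, c j ≠ 0) (hs : Function.Injective s) {m : Fin n → ℕ}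
    (h : ∀ j, G ∈ pointIdeal (c j • stdPoint (s j)) ^ m j) (hm : 2 * t < ∑ j, m j) :
    stdConic ∣ G := by
  refine stdConic_dvd_of_aeval_stdCurve_eq_zero hG ?_
  have hdvd : ∏ j, (Polynomial.X - Polynomial.C (s j)) ^ m j ∣ aeval stdCurve G :=
    Finset.prod_dvd_of_coprime
      (fun i _ j _ hij => (Polynomial.pairwise_coprime_X_sub_C hs hij).pow)
      fun j _ => X_sub_C_pow_dvd_aeval_stdCurve hG (hc j) (h j)
  refine Polynomial.eq_zero_of_dvd_of_natDegree_lt hdvd ?_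
  rw [Polynomial.natDegree_prod_of_monic _ _ fun j _ => (Polynomial.monic_X_sub_C _).pow _]
  have h2 := MvPolynomial.aeval_natDegree_le G hG.totalDegree_le stdCurve (n := 2) (fun i => by
    fin_cases i <;> simp [stdCurve])
  simp only [Polynomial.natDegree_pow, Polynomial.natDegree_X_sub_C, mul_one]
  omega

end StandardConic

section LinearChange

open MvPolynomial Matrix

/-- The substitution `F(X) ↦ F(AX)`. -/
noncomputable def linearSubst (A : Matrix (Fin 3) (Fin 3) ℂ) :
    MvPolynomial (Fin 3) ℂ →ₐ[ℂ] MvPolynomial (Fin 3) ℂ :=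
  aeval fun i => ∑ j, C (A i j) * X j

lemma eval_linearSubst (A : Matrix (Fin 3) (Fin 3) ℂ) (v : Fin 3 → ℂ)
    (F : MvPolynomial (Fin 3) ℂ) : eval v (linearSubst A F) = eval (A *ᵥ v) F := by
  induction F using MvPolynomial.induction_on with
  | C a => simp [linearSubst]
  | add p q hp hq => simp [hp, hq]
  | mul_X p i hp => simp [hp]; simp [linearSubst, mulVec, dotProduct]

lemma linearSubst_linearSubst {A B : Matrix (Fin 3) (Fin 3) ℂ} (h : A * B = 1)
    (F : MvPolynomial (Fin 3) ℂ) : linearSubst B (linearSubst A F) = F :=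
  MvPolynomial.funext fun w => by simp [eval_linearSubst, h]

lemma linearSubst_isHomogeneous (A : Matrix (Fin 3) (Fin 3) ℂ) {t : ℕ}
    {F : MvPolynomial (Fin 3) ℂ} (hF : F.IsHomogeneous t) : (linearSubst A F).IsHomogeneous t := by
  have := hF.aeval (fun i => ∑ j, C (A i j) * X j) (n := 1) fun i =>
    IsHomogeneous.sum _ _ _ fun j _ => isHomogeneous_C_mul_X _ _
  rwa [one_mul] at this

lemma linearSubst_mem_pointIdeal_pow (A : Matrix (Fin 3) (Fin 3) ℂ) {v : Fin 3 → ℂ} {m : ℕ}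
    {F : MvPolynomial (Fin 3) ℂ} (h : F ∈ pointIdeal (A *ᵥ v) ^ m) :
    linearSubst A F ∈ pointIdeal v ^ m :=
  map_mem_pow_of_forall_mem (linearSubst A).toRingHom (fun x hx => by
    rw [mem_pointIdeal] at hx ⊢
    exact (eval_linearSubst A v x).trans hx) h

/-- A cofactor of a form in a form is a form. -/
lemma isHomogeneous_cofactor {s t : ℕ} {Q H : MvPolynomial (Fin 3) ℂ} (hQ : Q.IsHomogeneous s)
    (hQH : (Q * H).IsHomogeneous t) (h0 : Q * H ≠ 0) :
    s ≤ t ∧ H.IsHomogeneous (t - s) := by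
  have hcomp : ∀ k, Q * homogeneousComponent k H = homogeneousComponent (s + k) (Q * H) := by
    intro k
    conv_rhs => rw [← sum_homogeneousComponent H, Finset.mul_sum, map_sum]
    simp_rw [homogeneousComponent_of_mem (hQ.mul (homogeneousComponent_isHomogeneous _ H))]
    simp only [add_right_inj, Finset.sum_ite_eq, Finset.mem_range]
    split_ifs with hk
    · rfl
    · rw [homogeneousComponent_eq_zero _ _ (by omega), mul_zero]
  have hQ0 : Q ≠ 0 := left_ne_zero_of_mul h0
  have hzero : ∀ k, s + k ≠ t → homogeneousComponent k H = 0 := by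
    intro k hk
    have := hcomp k
    rw [homogeneousComponent_of_mem hQH, if_neg hk] at this
    exact (mul_eq_zero.1 this).resolve_left hQ0
  have hst : s ≤ t := by
    by_contra hlt
    refine right_ne_zero_of_mul h0 ?_
    rw [← sum_homogeneousComponent H]
    exact Finset.sum_eq_zero fun k _ => hzero k (by omega)
  refine ⟨hst, ?_⟩
  rw [← sum_homogeneousComponent H]
  refine IsHomogeneous.sum _ _ _ fun k _ => ?_
  by_cases hk : s + k = t
  · obtain rfl : k = t - s := by omega
    exact homogeneousComponent_isHomogeneous _ _
  · rw [hzero k hk]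
    exact isHomogeneous_zero _ _ _

end LinearChange

section FivePoints

open MvPolynomial Matrix

/-- Five points in linearly general position lie on the image of the standard conic under a
linear change of coordinates. -/
lemma exists_linear_stdPoint (w : Fin 5 → Fin 3 → ℂ)
    (hw : ∀ i j k, i ≠ j → i ≠ k → j ≠ k → (Matrix.of ![w i, w j, w k]).det ≠ 0) :
    ∃ (A : Matrix (Fin 3) (Fin 3) ℂ) (c s : Fin 5 → ℂ), A.det ≠ 0 ∧ (∀ j, c j ≠ 0) ∧
      Function.Injective s ∧ ∀ j, w j = A *ᵥ (c j • stdPoint (s j)) := by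
  have hspan : ∀ u : Fin 3 → ℂ, ∃ a b c : ℂ, ∀ k, u k = a * w 0 k + b * w 1 k + c * w 2 k := by
    intro u
    have hdet : IsUnit (Matrix.of ![w 0, w 1, w 2]).det :=
      (hw 0 1 2 (by decide) (by decide) (by decide)).isUnit
    have h : (u ᵥ* (Matrix.of ![w 0, w 1, w 2])⁻¹) ᵥ* Matrix.of ![w 0, w 1, w 2] = u := by
      rw [vecMul_vecMul, nonsing_inv_mul _ hdet, vecMul_one]
    generalize u ᵥ* (Matrix.of ![w 0, w 1, w 2])⁻¹ = y at h
    refine ⟨y 0, y 1, y 2, fun k => ?_⟩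
    rw [← h]
    simp [vecMul, dotProduct, Fin.sum_univ_three]
  obtain ⟨a₀, a₁, a₂, ha⟩ := hspan (w 3)
  obtain ⟨b₀, b₁, b₂, hb⟩ := hspan (w 4)
  simp only [det_fin_three, of_apply, cons_val_zero, cons_val_one, cons_val] at hw
  have h012 := hw 0 1 2 (by decide) (by decide) (by decide)
  have ha₀ : a₀ ≠ 0 := by
    rintro rfl
    refine hw 1 2 3 (by decide) (by decide) (by decide) ?_
    simp only [ha]; ring
  have ha₁ : a₁ ≠ 0 := by
    rintro rfl
    refine hw 0 2 3 (by decide) (by decide) (by decide) ?_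
    simp only [ha]; ring
  have ha₂ : a₂ ≠ 0 := by
    rintro rfl
    refine hw 0 1 3 (by decide) (by decide) (by decide) ?_
    simp only [ha]; ring
  have hb₀ : b₀ ≠ 0 := by
    rintro rfl
    refine hw 1 2 4 (by decide) (by decide) (by decide) ?_
    simp only [hb]; ring
  have hb₁ : b₁ ≠ 0 := by
    rintro rfl
    refine hw 0 2 4 (by decide) (by decide) (by decide) ?_
    simp only [hb]; ring
  have hb₂ : b₂ ≠ 0 := by
    rintro rfl
    refine hw 0 1 4 (by decide) (by decide) (by decide) ?_
    simp only [hb]; ring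
  have h01 : a₀ * b₁ - a₁ * b₀ ≠ 0 := by
    intro h
    refine hw 2 3 4 (by decide) (by decide) (by decide) ?_
    simp only [ha, hb]
    linear_combination h * (w 0 0 * w 1 1 * w 2 2 - w 0 0 * w 1 2 * w 2 1 - w 0 1 * w 1 0 * w 2 2
      + w 0 1 * w 1 2 * w 2 0 + w 0 2 * w 1 0 * w 2 1 - w 0 2 * w 1 1 * w 2 0)
  have h02 : a₀ * b₂ - a₂ * b₀ ≠ 0 := by
    intro h
    refine hw 1 3 4 (by decide) (by decide) (by decide) ?_
    simp only [ha, hb]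
    linear_combination -h * (w 0 0 * w 1 1 * w 2 2 - w 0 0 * w 1 2 * w 2 1 - w 0 1 * w 1 0 * w 2 2
      + w 0 1 * w 1 2 * w 2 0 + w 0 2 * w 1 0 * w 2 1 - w 0 2 * w 1 1 * w 2 0)
  have h12 : a₁ * b₂ - a₂ * b₁ ≠ 0 := by
    intro h
    refine hw 0 3 4 (by decide) (by decide) (by decide) ?_
    simp only [ha, hb]
    linear_combination h * (w 0 0 * w 1 1 * w 2 2 - w 0 0 * w 1 2 * w 2 1 - w 0 1 * w 1 0 * w 2 2
      + w 0 1 * w 1 2 * w 2 0 + w 0 2 * w 1 0 * w 2 1 - w 0 2 * w 1 1 * w 2 0)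
  obtain ⟨μ, hμ⟩ := Set.Finite.infinite_compl
    (Set.toFinite ({0, a₀ / b₀, a₁ / b₁, a₂ / b₂} : Set ℂ)) |>.nonempty
  simp only [Set.mem_compl_iff, Set.mem_insert_iff, Set.mem_singleton_iff, not_or] at hμ
  obtain ⟨hμ, hμ₀, hμ₁, hμ₂⟩ := hμ
  rw [eq_div_iff hb₀] at hμ₀
  rw [eq_div_iff hb₁] at hμ₁
  rw [eq_div_iff hb₂] at hμ₂
  have hB : ∀ k, μ * w 4 k = μ * b₀ * w 0 k + μ * b₁ * w 1 k + μ * b₂ * w 2 k := fun k => by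
    rw [hb]; ring
  have g01 : a₀ * (μ * b₁) - a₁ * (μ * b₀) ≠ 0 := by
    convert mul_ne_zero hμ h01 using 1; ring
  have g02 : a₀ * (μ * b₂) - a₂ * (μ * b₀) ≠ 0 := by
    convert mul_ne_zero hμ h02 using 1; ring
  have g12 : a₁ * (μ * b₂) - a₂ * (μ * b₁) ≠ 0 := by
    convert mul_ne_zero hμ h12 using 1; ring
  have hB₀ := mul_ne_zero hμ hb₀
  have hB₁ := mul_ne_zero hμ hb₁
  have hB₂ := mul_ne_zero hμ hb₂
  generalize μ * b₀ = B₀ at *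
  generalize μ * b₁ = B₁ at *
  generalize μ * b₂ = B₂ at *
  clear hb h01 h02 h12
  obtain ⟨d₀, rfl⟩ : ∃ d, B₀ = d + a₀ := ⟨B₀ - a₀, by ring⟩
  obtain ⟨d₁, rfl⟩ : ∃ d, B₁ = d + a₁ := ⟨B₁ - a₁, by ring⟩
  obtain ⟨d₂, rfl⟩ : ∃ d, B₂ = d + a₂ := ⟨B₂ - a₂, by ring⟩
  have hd₀ : d₀ ≠ 0 := by rintro rfl; simp at hμ₀
  have hd₁ : d₁ ≠ 0 := by rintro rfl; simp at hμ₁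
  have hd₂ : d₂ ≠ 0 := by rintro rfl; simp at hμ₂
  have g01' : a₀ * d₁ - a₁ * d₀ ≠ 0 := by convert g01 using 1; ring
  have g02' : a₀ * d₂ - a₂ * d₀ ≠ 0 := by convert g02 using 1; ring
  have g12' : a₁ * d₂ - a₂ * d₁ ≠ 0 := by convert g12 using 1; ring
  let A : Matrix (Fin 3) (Fin 3) ℂ := Matrix.of fun r => ![
    a₀ * (d₀ + a₀) * w 0 r * ((d₁ + a₁) * (d₂ + a₂)) +
      a₁ * (d₁ + a₁) * w 1 r * ((d₀ + a₀) * (d₂ + a₂)) +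
      a₂ * (d₂ + a₂) * w 2 r * ((d₀ + a₀) * (d₁ + a₁)),
    -(a₀ * (d₀ + a₀) * w 0 r * (d₁ * (d₂ + a₂) + d₂ * (d₁ + a₁)) +
      a₁ * (d₁ + a₁) * w 1 r * (d₀ * (d₂ + a₂) + d₂ * (d₀ + a₀)) +
      a₂ * (d₂ + a₂) * w 2 r * (d₀ * (d₁ + a₁) + d₁ * (d₀ + a₀))),
    a₀ * (d₀ + a₀) * w 0 r * (d₁ * d₂) + a₁ * (d₁ + a₁) * w 1 r * (d₀ * d₂) +
      a₂ * (d₂ + a₂) * w 2 r * (d₀ * d₁)]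
  let κ : Fin 5 → ℂ := ![
    a₀ * (d₀ + a₀) * ((a₀ * d₁ - a₁ * d₀) * (a₀ * d₂ - a₂ * d₀)) / d₀ ^ 2,
    -(a₁ * (d₁ + a₁) * ((a₀ * d₁ - a₁ * d₀) * (a₁ * d₂ - a₂ * d₁))) / d₁ ^ 2,
    a₂ * (d₂ + a₂) * ((a₀ * d₂ - a₂ * d₀) * (a₁ * d₂ - a₂ * d₁)) / d₂ ^ 2,
    (d₀ + a₀) * (d₁ + a₁) * (d₂ + a₂),
    μ * (a₀ * a₁ * a₂)]
  let s : Fin 5 → ℂ := ![(d₀ + a₀) / d₀, (d₁ + a₁) / d₁, (d₂ + a₂) / d₂, 0, 1]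
  have hκ : ∀ j, κ j ≠ 0 := by
    intro j
    fin_cases j <;> simp [κ, *]
  have hAκ : ∀ j, A *ᵥ stdPoint (s j) = κ j • w j := by
    intro j
    funext r
    fin_cases j <;>
      simp only [A, κ, s, stdPoint, mulVec, dotProduct, Fin.sum_univ_three, of_apply,
        Pi.smul_apply, smul_eq_mul, cons_val_zero, cons_val_one, cons_val, Fin.zero_eta,
        Fin.mk_one, Fin.reduceFinMk]
    · field_simp
      ring
    · field_simp
      ring
    · field_simp
      ring
    · rw [ha]
      ring
    · linear_combination -(a₀ * a₁ * a₂) * hB r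
  have hA : ∀ j, w j = A *ᵥ ((κ j)⁻¹ • stdPoint (s j)) := fun j => by
    rw [mulVec_smul, hAκ, smul_smul, inv_mul_cancel₀ (hκ j), one_smul]
  refine ⟨A, fun j => (κ j)⁻¹, s, ?_, fun j => inv_ne_zero (hκ j), ?_, hA⟩
  · intro hdet
    obtain ⟨y, hy, hyA⟩ := exists_vecMul_eq_zero_iff.2 hdet
    refine h012 ?_
    have hy' : (Matrix.of ![w 0, w 1, w 2]).det = 0 := by
      refine exists_mulVec_eq_zero_iff.1 ⟨y, hy, ?_⟩
      have hzero : ∀ j, w j ⬝ᵥ y = 0 := fun j => by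
        rw [hA j, dotProduct_comm, dotProduct_mulVec, hyA, zero_dotProduct]
      funext r
      fin_cases r
      exacts [hzero 0, hzero 1, hzero 2]
    simpa only [det_fin_three, of_apply, cons_val_zero, cons_val_one, cons_val] using hy'
  · have e01 : (d₀ + a₀) / d₀ ≠ (d₁ + a₁) / d₁ := by
      rw [Ne, div_eq_div_iff hd₀ hd₁]
      exact fun h => g01' (by linear_combination h)
    have e02 : (d₀ + a₀) / d₀ ≠ (d₂ + a₂) / d₂ := by
      rw [Ne, div_eq_div_iff hd₀ hd₂]
      exact fun h => g02' (by linear_combination h)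
    have e12 : (d₁ + a₁) / d₁ ≠ (d₂ + a₂) / d₂ := by
      rw [Ne, div_eq_div_iff hd₁ hd₂]
      exact fun h => g12' (by linear_combination h)
    intro i j h
    fin_cases i <;> fin_cases j <;>
      simp [s, e01, e01.symm, e02, e02.symm, e12, e12.symm, hB₀, hB₁, hB₂, hB₀.symm,
        hB₁.symm, hB₂.symm, hd₀, hd₁, hd₂, div_eq_one_iff_eq, eq_div_iff, ha₀, ha₁, ha₂] at h ⊢

end FivePoints

section Bound

open MvPolynomial Matrix

/-- Five points in linearly general position lie on a conic `Q` which is smooth at these points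
and satisfies Bézout's theorem there. -/
lemma exists_conic_through_five (w : Fin 5 → Fin 3 → ℂ)
    (hw : ∀ i j k, i ≠ j → i ≠ k → j ≠ k → (Matrix.of ![w i, w j, w k]).det ≠ 0) :
    ∃ Q : MvPolynomial (Fin 3) ℂ, Q ≠ 0 ∧ Q.IsHomogeneous 2 ∧ (∀ j, eval (w j) Q = 0) ∧
      (∀ j, Q ∉ pointIdeal (w j) ^ 2) ∧
      ∀ (t : ℕ) (F : MvPolynomial (Fin 3) ℂ) (m : Fin 5 → ℕ), F.IsHomogeneous t →
        (∀ j, F ∈ pointIdeal (w j) ^ m j) → 2 * t < ∑ j, m j → Q ∣ F := by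
  obtain ⟨A, c, s, hA, hc, hs, hwA⟩ := exists_linear_stdPoint w hw
  have hAA : A⁻¹ * A = 1 := nonsing_inv_mul _ hA.isUnit
  have hAA' : A * A⁻¹ = 1 := mul_nonsing_inv _ hA.isUnit
  have hback := linearSubst_linearSubst hAA stdConic
  refine ⟨linearSubst A⁻¹ stdConic, ?_, linearSubst_isHomogeneous _ isHomogeneous_stdConic,
    fun j => ?_, fun j hj => ?_, fun t F m hF hm hlt => ?_⟩
  · intro h
    rw [h, map_zero] at hback
    exact stdConic_ne_zero hback.symm
  · rw [hwA, eval_linearSubst, mulVec_mulVec, hAA, one_mulVec]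
    exact mem_pointIdeal.1 (stdConic_mem_pointIdeal _ _)
  · rw [hwA] at hj
    have := linearSubst_mem_pointIdeal_pow A hj
    rw [hback] at this
    exact stdConic_notMem_pointIdeal_sq (hc j) _ this
  · have hdvd := stdConic_dvd_of_lt_sum (linearSubst_isHomogeneous A hF) hc hs
      (fun j => linearSubst_mem_pointIdeal_pow A (by rw [← hwA]; exact hm j)) hlt
    have := map_dvd (linearSubst A⁻¹) hdvd
    rwa [linearSubst_linearSubst hAA'] at this

/-- The degree of a form is bounded below by its multiplicities at six points, provided that
through any five of the points there is a conic as in `exists_conic_through_five` missing the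
sixth one. -/
lemma two_mul_sum_le_five_mul_degree (v : Fin 6 → Fin 3 → ℂ) (Q : Fin 6 → MvPolynomial (Fin 3) ℂ)
    (hQ : ∀ i, (Q i).IsHomogeneous 2) (hQi : ∀ i, eval (v i) (Q i) ≠ 0)
    (hQsmooth : ∀ i j, Q i ∉ pointIdeal (v (i.succAbove j)) ^ 2)
    (hbezout : ∀ i (t : ℕ) (F : MvPolynomial (Fin 3) ℂ) (m : Fin 5 → ℕ), F.IsHomogeneous t →
      (∀ j, F ∈ pointIdeal (v (i.succAbove j)) ^ m j) → 2 * t < ∑ j, m j → Q i ∣ F)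
    (t : ℕ) (F : MvPolynomial (Fin 3) ℂ) (m : Fin 6 → ℕ) (hF : F.IsHomogeneous t) (hF0 : F ≠ 0)
    (hm : ∀ j, F ∈ pointIdeal (v j) ^ m j) : 2 * ∑ j, m j ≤ 5 * t := by
  induction t using Nat.strong_induction_on generalizing F m with
  | _ t ih =>
    by_cases hlt : ∃ i : Fin 6, 2 * t < ∑ j, m (i.succAbove j)
    · obtain ⟨i, hi⟩ := hlt
      obtain ⟨H, rfl⟩ := hbezout i t F (fun j => m (i.succAbove j)) hF (fun j => hm _) hi
      obtain ⟨h2t, hH⟩ := isHomogeneous_cofactor (hQ i) hF hF0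
      have hmi : H ∈ pointIdeal (v i) ^ m i :=
        mem_pointIdeal_pow_of_mul_mem (k := 0)
          (by rw [zero_add, pow_one, mem_pointIdeal]; exact hQi i) (hm i)
      have key := ih (t - 2) (by omega) H (i.insertNth (m i) fun j => m (i.succAbove j) - 1) hH
        (right_ne_zero_of_mul hF0) (fun j => by
          rcases Fin.eq_self_or_eq_succAbove i j with rfl | ⟨j, rfl⟩
          · simpa using hmi
          · simpa using mem_pointIdeal_pow_of_mul_mem (hQsmooth i j) (hm _))
      rw [Fin.sum_univ_succAbove _ i] at key ⊢
      simp only [Fin.insertNth_apply_same, Fin.insertNth_apply_succAbove,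
        Fin.sum_univ_five] at key ⊢
      omega
    · push Not at hlt
      have hle : ∀ i, ∑ j, m j ≤ m i + 2 * t := fun i => by
        rw [Fin.sum_univ_succAbove _ i]
        exact Nat.add_le_add_left (hlt i) _
      have hsum := Finset.sum_le_sum fun i (_ : i ∈ Finset.univ) => hle i
      simp only [Finset.sum_const, Finset.card_univ, Fintype.card_fin, smul_eq_mul,
        Finset.sum_add_distrib] at hsum
      omega

/-- For a form, vanishing at one representative of a point means vanishing at the point. -/
lemma memLine_of_eval_rep {t : ℕ} {F : MvPolynomial (Fin 3) ℂ} (hF : F.IsHomogeneous t)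
    {p : ℙ ℂ (Fin 3 → ℂ)} (h : eval p.rep F = 0) : MemLine F p := by
  rintro v hv rfl
  obtain ⟨a, ha⟩ := (Projectivization.mk_eq_mk_iff' ℂ v _ hv (Projectivization.rep_nonzero _)).1
    (Projectivization.mk_rep (Projectivization.mk ℂ v hv)).symm
  rw [← ha, ← aeval_eq_eval]
  rw [← aeval_eq_eval] at h
  exact (hF.aeval_mul a (Projectivization.mk ℂ v hv).rep).trans (by rw [h, mul_zero])

/-- Three points whose representatives are linearly dependent are collinear. -/
lemma collin_of_det_eq_zero (x y z : ℙ ℂ (Fin 3 → ℂ))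
    (h : (Matrix.of ![x.rep, y.rep, z.rep]).det = 0) : Collin x y z := by
  obtain ⟨n, hn, hn0⟩ := exists_mulVec_eq_zero_iff.2 h
  have hL : (∑ i, C (n i) * X i : MvPolynomial (Fin 3) ℂ).IsHomogeneous 1 :=
    IsHomogeneous.sum _ _ _ fun j _ => isHomogeneous_C_mul_X _ _
  have hmem : ∀ p : ℙ ℂ (Fin 3 → ℂ), p.rep ⬝ᵥ n = 0 →
      MemLine (∑ i, C (n i) * X i : MvPolynomial (Fin 3) ℂ) p := fun p hp =>
    memLine_of_eval_rep hL (by simpa [dotProduct, mul_comm] using hp)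
  refine ⟨∑ i, C (n i) * X i, ⟨fun h0 => hn ?_, hL⟩, hmem x ?_, hmem y ?_, hmem z ?_⟩
  · funext k
    have := congrArg (eval (Pi.single k 1)) h0
    simpa [Pi.single_apply] using this
  · exact congrFun hn0 0
  · exact congrFun hn0 1
  · exact congrFun hn0 2

end Bound

section SixPoints

open MvPolynomial

/-- Membership in the symbolic power, in terms of powers of the ideals of the points. -/
lemma mem_symbolicPower_iff {Z : Set (ℙ ℂ (Fin 3 → ℂ))} {m : ℕ} {F : MvPolynomial (Fin 3) ℂ} :
    F ∈ symbolicPower Z m ↔ ∀ (v : Fin 3 → ℂ) (hv : v ≠ 0),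
      Projectivization.mk ℂ v hv ∈ Z → F ∈ pointIdeal v ^ m := by
  refine ⟨fun h v hv hZ => vanishesToOrder_iff.1 (h _ hZ v hv rfl), ?_⟩
  rintro h _ hZ v hv rfl
  exact vanishesToOrder_iff.2 (h v hv hZ)

lemma pow_mem_symbolicPower {Z : Set (ℙ ℂ (Fin 3 → ℂ))} {m : ℕ} {F : MvPolynomial (Fin 3) ℂ}
    (hF : F ∈ symbolicPower Z m) (k : ℕ) : F ^ k ∈ symbolicPower Z (m * k) := by
  rw [mem_symbolicPower_iff] at hF ⊢
  intro v hv hZ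
  rw [pow_mul]
  exact Ideal.pow_mem_pow (hF v hv hZ) k

lemma symbolicPower_anti (Z : Set (ℙ ℂ (Fin 3 → ℂ))) : Antitone (symbolicPower Z) :=
  fun _ _ h _ hF P hP v hv hvP k hk => hF P hP v hv hvP k (hk.trans_le h)

lemma exists_injective_range_eq {α : Type*} {Z : Set α} {n : ℕ} (hfin : Z.Finite)
    (hcard : Z.ncard = n) : ∃ P : Fin n → α, Function.Injective P ∧ Set.range P = Z := by
  have := hfin.fintype
  have e : Z ≃ Fin n := Fintype.equivFinOfCardEq (by
    rw [← hcard, Set.ncard_eq_toFinset_card', Set.toFinset_card])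
  exact ⟨fun i => e.symm i, Subtype.val_injective.comp e.symm.injective, by
    rw [← Function.comp_def, Set.range_comp, e.symm.surjective.range_eq, Set.image_univ,
      Subtype.range_coe]⟩

end SixPoints

/-- Six points of `ℙ²`, no three collinear and not contained in a conic, have Waldschmidt
constant `12/5`. -/
theorem waldschmidt_six_general_points (Z : Set (ℙ ℂ (Fin 3 → ℂ)))
    (hfin : Z.Finite) (hcard : Z.ncard = 6)
    (hgen : ∀ X Y W, X ∈ Z → Y ∈ Z → W ∈ Z → X ≠ Y → X ≠ W → Y ≠ W → ¬ Collin X Y W)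
    (hconic : ¬ ContainedInConic Z) :
    waldschmidt Z = 12 / 5 := by
  obtain ⟨P, hPinj, hPZ⟩ := exists_injective_range_eq hfin hcard
  have hPmem : ∀ i, P i ∈ Z := fun i => hPZ ▸ Set.mem_range_self i
  choose Q hQ0 hQ hQzero hQsmooth hbezout using fun i : Fin 6 =>
    exists_conic_through_five (fun j => (P (i.succAbove j)).rep) fun a b c hab hac hbc hdet =>
      hgen _ _ _ (hPmem _) (hPmem _) (hPmem _)
        (hPinj.ne (Fin.succAbove_right_injective.ne hab))
        (hPinj.ne (Fin.succAbove_right_injective.ne hac))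
        (hPinj.ne (Fin.succAbove_right_injective.ne hbc)) (collin_of_det_eq_zero _ _ _ hdet)
  have hQi : ∀ i, MvPolynomial.eval (P i).rep (Q i) ≠ 0 := fun i h => by
    refine hconic ⟨Q i, hQ0 i, hQ i, ?_⟩
    rw [← hPZ]
    rintro _ ⟨j, rfl⟩
    rcases Fin.eq_self_or_eq_succAbove i j with rfl | ⟨j, rfl⟩
    · exact memLine_of_eval_rep (hQ _) h
    · exact memLine_of_eval_rep (hQ i) (hQzero i j)
  have hG0 : ∏ i, Q i ≠ 0 := Finset.prod_ne_zero_iff.2 fun i _ => hQ0 i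
  have hG : (∏ i, Q i).IsHomogeneous 12 := by
    simpa using MvPolynomial.IsHomogeneous.prod Finset.univ Q (fun _ => 2) fun i _ => hQ i
  have hGmem : ∏ i, Q i ∈ symbolicPower Z 5 := by
    refine mem_symbolicPower_iff.2 fun v hv hZ => ?_
    rw [← hPZ] at hZ
    obtain ⟨j, hj⟩ := hZ
    rw [Fin.prod_univ_succAbove _ j]
    refine Ideal.mul_mem_left _ _ ?_
    have hmem : ∀ k, Q (j.succAbove k) ∈ pointIdeal v := fun k => by
      rcases Fin.eq_self_or_eq_succAbove (j.succAbove k) j with h | ⟨l, hl⟩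
      · exact absurd h.symm (Fin.succAbove_ne j k)
      · refine mem_pointIdeal.2 (memLine_of_eval_rep (hQ _) ?_ v hv hj.symm)
        have := hQzero (j.succAbove k) l
        rwa [← hl] at this
    simpa using Ideal.prod_mem_prod (s := Finset.univ) fun k _ => hmem k
  have hbdd : BddBelow (Set.range fun m : ℕ+ =>
      (initialDegree (symbolicPower Z (m : ℕ)) : ℝ) / ((m : ℕ) : ℝ)) :=
    ⟨0, by rintro _ ⟨m, rfl⟩; positivity⟩
  refine le_antisymm ((ciInf_le hbdd 5).trans ?_) (le_ciInf fun m => ?_)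
  · have h12 : initialDegree (symbolicPower Z 5) ≤ 12 := Nat.sInf_le ⟨_, hGmem, hG0, hG⟩
    have h12' : (initialDegree (symbolicPower Z 5) : ℝ) ≤ 12 := by exact_mod_cast h12
    change (initialDegree (symbolicPower Z 5) : ℝ) / ((5 : ℕ) : ℝ) ≤ 12 / 5
    push_cast
    gcongr
  · obtain ⟨F, hFmem, hF0, hF⟩ := Nat.sInf_mem
      (s := {t | ∃ F ∈ symbolicPower Z m, F ≠ 0 ∧ F.IsHomogeneous t})
      ⟨_, _, symbolicPower_anti Z (Nat.le_mul_of_pos_left m (by norm_num : 0 < 5))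
        (pow_mem_symbolicPower hGmem m), pow_ne_zero _ hG0, hG.pow m⟩
    have key := two_mul_sum_le_five_mul_degree (fun i => (P i).rep) Q hQ hQi hQsmooth hbezout
      _ F (fun _ => m) hF hF0 fun j => mem_symbolicPower_iff.1 hFmem _ (P j).rep_nonzero
        (by rw [Projectivization.mk_rep]; exact hPmem j)
    simp only [Finset.sum_const, Finset.card_univ, Fintype.card_fin, smul_eq_mul] at key
    change 2 * (6 * (m : ℕ)) ≤ 5 * initialDegree (symbolicPower Z m) at key
    have key' : (2 * (6 * (m : ℕ)) : ℝ) ≤ 5 * initialDegree (symbolicPower Z m) := by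
      exact_mod_cast key
    rw [div_le_div_iff₀ (by norm_num) (by exact_mod_cast m.pos)]
    linarith
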